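/- Every centrally symmetric, absolutely continuous log-concave distribution on R^n is central convex unimodal, and consequently monotone unimodal: for every symmetric convex set R and nonzero x, the map k ↦ Pr(w + k·x ∈ R) is non-increasing on [0,∞). In particular this holds for any nondegenerate zero-mean multivariate Gaussian distribution. -/

import Mathlib

open MeasureTheory ProbabilityTheory
open scoped ENNReal

/-- A probability measure on `ℝᵈ` given as the uniform distribution on a symmetric
compact convex body. -/
def IsUniformOnSymmetricBody {d : ℕ} (ν : ProbabilityMeasure (Fin d → ℝ)) : Prop :=
  ∃ K : Set (Fin d → ℝ), IsCompact K ∧ Convex ℝ K ∧ K = -K ∧ 0 < volume K ∧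
    (ν : Measure (Fin d → ℝ)) = (volume K)⁻¹ • volume.restrict K

/-- A finite convex combination of uniform distributions on symmetric compact convex bodies. -/
def IsConvexComboOfSymmetricUniforms {d : ℕ} (ν : ProbabilityMeasure (Fin d → ℝ)) : Prop :=
  ∃ (m : ℕ) (wt : Fin m → ℝ≥0∞) (f : Fin m → ProbabilityMeasure (Fin d → ℝ)),
    (∑ i, wt i) = 1 ∧ (∀ i, IsUniformOnSymmetricBody (f i)) ∧
    (ν : Measure (Fin d → ℝ)) = ∑ i, wt i • (f i : Measure (Fin d → ℝ))

/-- **Central convex unimodality**: the distribution lies in the closed convex hull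
(w.r.t. the topology of weak convergence) of the uniform distributions on symmetric
compact convex bodies. -/
def IsCentralConvexUnimodal {d : ℕ} (μ : Measure (Fin d → ℝ)) : Prop :=
  ∃ h : IsProbabilityMeasure μ,
    (⟨μ, h⟩ : ProbabilityMeasure (Fin d → ℝ)) ∈
      closure {ν | IsConvexComboOfSymmetricUniforms ν}

open scoped Pointwise in
lemma bm1_compact {A B C : Set ℝ} {t : ℝ} (ht0 : 0 < t) (ht1 : t < 1)
    (hA : IsCompact A) (hB : IsCompact B) (hAn : A.Nonempty) (hBn : B.Nonempty)
    (h : ∀ a ∈ A, ∀ b ∈ B, t * a + (1 - t) * b ∈ C) :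
    ENNReal.ofReal t * volume A + ENNReal.ofReal (1 - t) * volume B ≤ volume C := by
  have hM := hA.sSup_mem hAn
  have hm := hB.sInf_mem hBn
  set M := sSup A
  set m := sInf B
  have key : ∀ (s c : ℝ) (D : Set ℝ), 0 < s →
      volume ((fun a => s * a + c) '' D) = ENNReal.ofReal s * volume D := by
    intro s c D hs
    have : (fun a => s * a + c) '' D = (fun x => x + c) '' (s • D : Set ℝ) := by
      rw [← Set.image_smul, Set.image_image]; rfl
    rw [this, Set.image_add_right, measure_preimage_add_right, Measure.addHaar_smul]
    simp [abs_of_pos hs]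
  rw [← key t ((1 - t) * m) A ht0, ← key (1 - t) (t * M) B (by linarith), ← measure_union₀]
  · apply measure_mono
    rintro x (⟨a, ha, rfl⟩ | ⟨b, hb, rfl⟩)
    · exact h a ha m hm
    · have := h M hM b hb
      simpa [add_comm] using this
  · exact ((hB.image (by fun_prop)).measurableSet).nullMeasurableSet
  · refine measure_mono_null (t := {t * M + (1 - t) * m}) ?_ (by simp)
    rintro x ⟨⟨a, ha, rfl⟩, ⟨b, hb, hbe⟩⟩
    have h1 : a ≤ M := le_csSup hA.bddAbove ha
    have h2 : m ≤ b := csInf_le hB.bddBelow hb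
    simp only [Set.mem_singleton_iff] at hbe ⊢
    nlinarith [mul_le_mul_of_nonneg_left h1 ht0.le,
      mul_le_mul_of_nonneg_left h2 (sub_pos.2 ht1).le]

lemma vol_eq_iSup {A : Set ℝ} (hA : MeasurableSet A) (hAn : A.Nonempty) :
    volume A = ⨆ K : {K : Set ℝ // K ⊆ A ∧ IsCompact K ∧ K.Nonempty}, volume K.1 := by
  apply le_antisymm
  · apply le_of_forall_lt
    intro r hr
    obtain ⟨K, hK, hKc, hr⟩ := hA.exists_lt_isCompact hr
    have hne : K.Nonempty := by
      by_contra hh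
      rw [Set.not_nonempty_iff_eq_empty] at hh
      simp [hh] at hr
    exact hr.trans_le (le_iSup (fun K : {K : Set ℝ // K ⊆ A ∧ IsCompact K ∧ K.Nonempty} =>
      volume K.1) ⟨K, hK, hKc, hne⟩)
  · exact iSup_le fun K => measure_mono K.2.1

lemma bm1 {A B C : Set ℝ} {t : ℝ} (ht0 : 0 < t) (ht1 : t < 1)
    (hA : MeasurableSet A) (hB : MeasurableSet B) (hAn : A.Nonempty) (hBn : B.Nonempty)
    (h : ∀ a ∈ A, ∀ b ∈ B, t * a + (1 - t) * b ∈ C) :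
    ENNReal.ofReal t * volume A + ENNReal.ofReal (1 - t) * volume B ≤ volume C := by
  obtain ⟨a, ha⟩ := hAn
  obtain ⟨b, hb⟩ := hBn
  have : Nonempty {K : Set ℝ // K ⊆ A ∧ IsCompact K ∧ K.Nonempty} :=
    ⟨⟨{a}, by simpa using ha, isCompact_singleton, by simp⟩⟩
  have : Nonempty {K : Set ℝ // K ⊆ B ∧ IsCompact K ∧ K.Nonempty} :=
    ⟨⟨{b}, by simpa using hb, isCompact_singleton, by simp⟩⟩
  rw [vol_eq_iSup hA ⟨a, ha⟩, vol_eq_iSup hB ⟨b, hb⟩, ENNReal.mul_iSup, ENNReal.mul_iSup]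
  apply ENNReal.iSup_add_iSup_le
  intro K L
  exact bm1_compact ht0 ht1 K.2.2.1 L.2.2.1 K.2.2.2 L.2.2.2
    fun a ha b hb => h a (K.2.1 ha) b (L.2.1 hb)

lemma layer1 {F : ℝ → ℝ≥0∞} (hF : Measurable F) (h1 : ∀ x, F x ≤ 1) :
    ∫⁻ x, F x = ∫⁻ s in Set.Ioo (0:ℝ) 1, volume {x | ENNReal.ofReal s < F x} := by
  have e : ∀ x, F x = ENNReal.ofReal (F x).toReal := fun x =>
    (ENNReal.ofReal_toReal (ne_top_of_le_ne_top ENNReal.one_ne_top (h1 x))).symm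
  have e2 : ∫⁻ x, F x = ∫⁻ s in Set.Ioi (0:ℝ), volume {x | s < (F x).toReal} := by
    rw [← lintegral_eq_lintegral_meas_lt]
    · exact lintegral_congr e
    · exact Filter.Eventually.of_forall fun x => ENNReal.toReal_nonneg
    · exact hF.ennreal_toReal.aemeasurable
  rw [e2, ← Set.Ioo_union_Ici_eq_Ioi (zero_lt_one), lintegral_union measurableSet_Ici]
  · have : ∫⁻ s in Set.Ici (1:ℝ), volume {x | s < (F x).toReal} = 0 := by
      rw [setLIntegral_congr_fun (g := fun _ => 0) measurableSet_Ici]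
      · simp
      · intro s hs
        have : {x | s < (F x).toReal} = ∅ := by
          ext x
          simp only [Set.mem_ofPred_eq, Set.mem_empty_iff_false, iff_false, not_lt]
          refine le_trans ?_ hs
          exact ENNReal.toReal_le_of_le_ofReal zero_le_one (by simpa using h1 x)
        simp [this]
    rw [this, add_zero]
    apply setLIntegral_congr_fun measurableSet_Ioo
    intro s hs
    simp only
    congr 1
    ext x
    simp only [Set.mem_ofPred_eq]
    conv_rhs => rw [e x]
    rw [ENNReal.ofReal_lt_ofReal_iff_of_nonneg hs.1.le]
  · rw [Set.disjoint_left]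
    intro x hx hx'
    exact absurd hx.2 (not_lt.2 hx')

lemma amgm_ennreal {t : ℝ} (ht0 : 0 < t) (ht1 : t < 1) (a b : ℝ≥0∞) :
    a ^ t * b ^ (1 - t) ≤ ENNReal.ofReal t * a + ENNReal.ofReal (1 - t) * b := by
  have p1 : ENNReal.ofReal t ≠ 0 := by simpa using ht0
  have p2 : ENNReal.ofReal (1 - t) ≠ 0 := by simpa using ht1
  rcases eq_or_ne a ⊤ with rfl | ha
  · rw [ENNReal.mul_top p1]; simp
  rcases eq_or_ne b ⊤ with rfl | hb
  · rw [ENNReal.mul_top p2]; simp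
  lift a to NNReal using ha
  lift b to NNReal using hb
  have := NNReal.geom_mean_le_arith_mean2_weighted t.toNNReal (1 - t).toNNReal a b
    (by rw [← Real.toNNReal_add ht0.le (by linarith)]; simp)
  rw [Real.coe_toNNReal _ ht0.le, Real.coe_toNNReal _ (by linarith : (0:ℝ) ≤ 1 - t)] at this
  rw [← ENNReal.coe_rpow_of_nonneg _ ht0.le, ← ENNReal.coe_rpow_of_nonneg _ (by linarith)]
  have e : ∀ s : ℝ, ENNReal.ofReal s = (s.toNNReal : ℝ≥0∞) := fun s => rfl
  rw [e, e]
  exact_mod_cast this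

/-- normalized one-dimensional inequality -/
lemma pl1_norm {t : ℝ} (ht0 : 0 < t) (ht1 : t < 1) {F G H : ℝ → ℝ≥0∞}
    (hF : Measurable F) (hG : Measurable G) (hH : Measurable H)
    (hF1 : ⨆ x, F x = 1) (hG1 : ⨆ x, G x = 1)
    (h : ∀ x y, F x ^ t * G y ^ (1 - t) ≤ H (t * x + (1 - t) * y)) :
    (∫⁻ x, F x) ^ t * (∫⁻ x, G x) ^ (1 - t) ≤ ∫⁻ x, H x := by
  have hFle : ∀ x, F x ≤ 1 := fun x => hF1 ▸ le_iSup F x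
  have hGle : ∀ x, G x ≤ 1 := fun x => hG1 ▸ le_iSup G x
  refine (amgm_ennreal ht0 ht1 _ _).trans ?_
  refine le_trans ?_ (lintegral_mono (fun x => min_le_left (H x) 1))
  rw [layer1 hF hFle, layer1 hG hGle, layer1 (hH.min measurable_const) (fun x => min_le_right _ _)]
  have anti : ∀ F : ℝ → ℝ≥0∞, Measurable fun s : ℝ => volume {x | ENNReal.ofReal s < F x} := by
    intro F
    apply Antitone.measurable
    intro s s' hs
    exact measure_mono fun x hx => lt_of_le_of_lt (ENNReal.ofReal_le_ofReal hs) hx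
  rw [← lintegral_const_mul _ (anti F), ← lintegral_const_mul _ (anti G),
    ← lintegral_add_left ((anti F).const_mul _)]
  apply setLIntegral_mono ((anti _))
  intro s hs
  have hs1 : ENNReal.ofReal s < 1 := by simpa using hs.2
  apply bm1 ht0 ht1 (measurableSet_lt measurable_const hF) (measurableSet_lt measurable_const hG)
  · rw [← hF1] at hs1
    exact lt_iSup_iff.1 hs1
  · rw [← hG1] at hs1
    exact lt_iSup_iff.1 hs1
  · intro a ha b hb
    simp only [Set.mem_ofPred_eq, lt_min_iff] at ha hb ⊢
    refine ⟨lt_of_lt_of_le ?_ (h a b), hs1⟩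
    have e : ENNReal.ofReal s = ENNReal.ofReal s ^ t * ENNReal.ofReal s ^ (1 - t) := by
      rw [← ENNReal.rpow_add_of_nonneg _ _ ht0.le (by linarith)]; simp
    rw [e]
    exact ENNReal.mul_lt_mul (ENNReal.rpow_lt_rpow ha ht0)
      (ENNReal.rpow_lt_rpow hb (by linarith))

lemma pl1_bdd {t : ℝ} (ht0 : 0 < t) (ht1 : t < 1) {F G H : ℝ → ℝ≥0∞}
    (hF : Measurable F) (hG : Measurable G) (hH : Measurable H)
    (hF1 : ⨆ x, F x ≠ ⊤) (hG1 : ⨆ x, G x ≠ ⊤)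
    (h : ∀ x y, F x ^ t * G y ^ (1 - t) ≤ H (t * x + (1 - t) * y)) :
    (∫⁻ x, F x) ^ t * (∫⁻ x, G x) ^ (1 - t) ≤ ∫⁻ x, H x := by
  have ht2 : 0 < 1 - t := by linarith
  rcases eq_or_ne (⨆ x, F x) 0 with h0 | h0
  · have : ∀ x, F x = 0 := by simpa using h0
    simp [this, ht0]
  rcases eq_or_ne (⨆ x, G x) 0 with h0' | h0'
  · have : ∀ x, G x = 0 := by simpa using h0'
    simp [this, ht1]
  set M := ⨆ x, F x
  set N := ⨆ x, G x
  have := pl1_norm ht0 ht1 (F := fun x => M⁻¹ * F x) (G := fun x => N⁻¹ * G x)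
    (H := fun x => (M⁻¹ ^ t * N⁻¹ ^ (1 - t)) * H x) (hF.const_mul _) (hG.const_mul _)
    (hH.const_mul _) (by rw [← ENNReal.mul_iSup]; exact ENNReal.inv_mul_cancel h0 hF1)
    (by rw [← ENNReal.mul_iSup]; exact ENNReal.inv_mul_cancel h0' hG1) ?_
  · rw [lintegral_const_mul _ hF, lintegral_const_mul _ hG, lintegral_const_mul _ hH,
      ENNReal.mul_rpow_of_nonneg _ _ ht0.le, ENNReal.mul_rpow_of_nonneg _ _ ht2.le,
      mul_mul_mul_comm] at this
    refine (ENNReal.mul_le_mul_iff_right ?_ ?_).1 this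
    · refine mul_ne_zero ?_ ?_
      · simp [ENNReal.rpow_eq_zero_iff, hF1, ht0.le, h0]
      · simp [ENNReal.rpow_eq_zero_iff, hG1, ht2.le, h0', ht1.le]
    · refine ENNReal.mul_ne_top ?_ ?_
      · exact ENNReal.rpow_ne_top_of_nonneg ht0.le (by simpa using h0)
      · exact ENNReal.rpow_ne_top_of_nonneg ht2.le (by simpa using h0')
  · intro x y
    rw [ENNReal.mul_rpow_of_nonneg _ _ ht0.le, ENNReal.mul_rpow_of_nonneg _ _ ht2.le,
      mul_mul_mul_comm]
    gcongr
    exact h x y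

lemma lintegral_trunc {F : ℝ → ℝ≥0∞} (hF : Measurable F) :
    Filter.Tendsto (fun n : ℕ => ∫⁻ x, min (F x) n) Filter.atTop (nhds (∫⁻ x, F x)) := by
  apply lintegral_tendsto_of_tendsto_of_monotone
  · exact fun n => (hF.min measurable_const).aemeasurable
  · refine Filter.Eventually.of_forall fun x m n hmn => ?_
    exact min_le_min le_rfl (by exact_mod_cast hmn)
  · refine Filter.Eventually.of_forall fun x => ?_
    have := (tendsto_const_nhds (x := F x) (f := Filter.atTop)).min ENNReal.tendsto_nat_nhds_top
    simpa using this

lemma pl1 {t : ℝ} (ht0 : 0 < t) (ht1 : t < 1) {F G H : ℝ → ℝ≥0∞}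
    (hF : Measurable F) (hG : Measurable G) (hH : Measurable H)
    (h : ∀ x y, F x ^ t * G y ^ (1 - t) ≤ H (t * x + (1 - t) * y)) :
    (∫⁻ x, F x) ^ t * (∫⁻ x, G x) ^ (1 - t) ≤ ∫⁻ x, H x := by
  have ht2 : 0 < 1 - t := by linarith
  have key : ∀ n : ℕ, (∫⁻ x, min (F x) n) ^ t * (∫⁻ x, min (G x) n) ^ (1 - t) ≤ ∫⁻ x, H x := by
    intro n
    apply pl1_bdd ht0 ht1 (hF.min measurable_const) (hG.min measurable_const) hH
    · exact ne_top_of_le_ne_top (ENNReal.natCast_ne_top n) (iSup_le fun x => min_le_right _ _)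
    · exact ne_top_of_le_ne_top (ENNReal.natCast_ne_top n) (iSup_le fun x => min_le_right _ _)
    · intro x y
      refine le_trans ?_ (h x y)
      gcongr
      · exact min_le_left _ _
      · exact min_le_left _ _
  rcases eq_or_ne (∫⁻ x, F x) 0 with h0 | h0
  · simp [h0, ht0]
  rcases eq_or_ne (∫⁻ x, G x) 0 with h0' | h0'
  · simp [h0', ht1]
  have l1 := ((ENNReal.continuous_rpow_const (y := t)).tendsto _).comp (lintegral_trunc hF)
  have l2 := ((ENNReal.continuous_rpow_const (y := 1 - t)).tendsto _).comp (lintegral_trunc hG)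
  refine le_of_tendsto' (ENNReal.Tendsto.mul l1 (Or.inl ?_) l2 (Or.inl ?_)) key
  · simp [ENNReal.rpow_eq_zero_iff, h0, ht0.le]
  · simp [ENNReal.rpow_eq_zero_iff, h0', ht1.le]

lemma pln {t : ℝ} (ht0 : 0 < t) (ht1 : t < 1) (n : ℕ) : ∀ {F G H : (Fin n → ℝ) → ℝ≥0∞},
    Measurable F → Measurable G → Measurable H →
    (∀ x y, F x ^ t * G y ^ (1 - t) ≤ H (t • x + (1 - t) • y)) →
    (∫⁻ x, F x) ^ t * (∫⁻ x, G x) ^ (1 - t) ≤ ∫⁻ x, H x := by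
  induction n with
  | zero =>
    intro F G H hF hG hH h
    simp only [volume_pi, Measure.pi_of_empty _ (0 : Fin 0 → ℝ)]
    rw [lintegral_dirac, lintegral_dirac, lintegral_dirac]
    simpa using h 0 0
  | succ n ih =>
    intro F G H hF hG hH h
    let e := (MeasurableEquiv.piFinSuccAbove (fun _ : Fin (n+1) => ℝ) 0).symm
    have he : MeasurePreserving e volume volume :=
      (volume_preserving_piFinSuccAbove (fun _ : Fin (n+1) => ℝ) 0).symm _
    have hi : ∀ F : (Fin (n+1) → ℝ) → ℝ≥0∞, Measurable F →
        ∫⁻ x, F x = ∫⁻ a : ℝ, ∫⁻ x : Fin n → ℝ, F (e (a, x)) := by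
      intro F hF
      rw [← he.lintegral_comp hF]
      exact lintegral_prod _ (hF.comp e.measurable).aemeasurable
    have hm : ∀ F : (Fin (n+1) → ℝ) → ℝ≥0∞, Measurable F →
        Measurable fun p : ℝ × (Fin n → ℝ) => F (e p) := fun F hF => hF.comp e.measurable
    rw [hi F hF, hi G hG, hi H hH]
    apply pl1 ht0 ht1 (hm F hF).lintegral_prod_right' (hm G hG).lintegral_prod_right'
      (hm H hH).lintegral_prod_right'
    intro a b
    apply ih
    · exact (hm F hF).comp measurable_prodMk_left
    · exact (hm G hG).comp measurable_prodMk_left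
    · exact (hm H hH).comp measurable_prodMk_left
    · intro x y
      have := h (e (a, x)) (e (b, y))
      convert this using 2
      ext i
      refine Fin.cases ?_ (fun i => ?_) i
      · simp [e, MeasurableEquiv.piFinSuccAbove]
      · simp [e, MeasurableEquiv.piFinSuccAbove]

/-- Version for not necessarily measurable functions. -/
lemma pln' {t : ℝ} (ht0 : 0 < t) (ht1 : t < 1) {n : ℕ} {F G H : (Fin n → ℝ) → ℝ≥0∞}
    (hH : AEMeasurable H)
    (h : ∀ x y, F x ^ t * G y ^ (1 - t) ≤ H (t • x + (1 - t) • y)) :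
    (∫⁻ x, F x) ^ t * (∫⁻ x, G x) ^ (1 - t) ≤ ∫⁻ x, H x := by
  classical
  obtain ⟨F', hF', hFl, hFi⟩ := exists_measurable_le_lintegral_eq volume F
  obtain ⟨G', hG', hGl, hGi⟩ := exists_measurable_le_lintegral_eq volume G
  obtain ⟨N, hN, hNm, hN0⟩ := exists_measurable_superset_of_null (ae_iff.1 hH.ae_eq_mk)
  let H' : (Fin n → ℝ) → ℝ≥0∞ := N.piecewise (fun _ => ⊤) (hH.mk H)
  have hH'm : Measurable H' := Measurable.piecewise hNm measurable_const hH.measurable_mk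
  have hle : ∀ x, H x ≤ H' x := by
    intro x
    by_cases hx : x ∈ N
    · simp [H', hx]
    · have : H x = hH.mk H x := by
        by_contra hh
        exact hx (hN hh)
      simp [H', hx, this]
  have hHi : ∫⁻ x, H x = ∫⁻ x, H' x := by
    apply lintegral_congr_ae
    have : ∀ᵐ x, x ∉ N := by simpa [ae_iff] using hN0
    filter_upwards [this, hH.ae_eq_mk] with x hx hx'
    simp [H', hx, hx']
  rw [hFi, hGi, hHi]
  apply pln ht0 ht1 n hF' hG' hH'm
  intro x y
  refine le_trans ?_ ((h x y).trans (hle _))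
  gcongr
  · exact hFl x
  · exact hGl y

section
variable {d : ℕ} {f : (Fin d → ℝ) → ℝ}

lemma lvl_convex (hf0 : ∀ x, 0 ≤ f x)
    (hlc : ∀ x y : Fin d → ℝ, ∀ t : ℝ, t ∈ Set.Icc (0:ℝ) 1 →
      f x ^ t * f y ^ (1 - t) ≤ f (t • x + (1 - t) • y)) (s : ℝ) :
    Convex ℝ {x | s ≤ f x} := by
  rcases le_or_gt s 0 with hs | hs
  · have : {x | s ≤ f x} = Set.univ := by
      ext x; simpa using hs.trans (hf0 x)
    rw [this]; exact convex_univ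
  · intro x hx y hy a b ha hb hab
    obtain rfl : b = 1 - a := by linarith
    refine le_trans ?_ (hlc x y a ⟨ha, by linarith⟩)
    have e : s = s ^ a * s ^ (1 - a) := by
      rw [← Real.rpow_add hs]; simp
    have hx' : s ≤ f x := hx
    have hy' : s ≤ f y := hy
    calc s = s ^ a * s ^ (1 - a) := e
      _ ≤ f x ^ a * f y ^ (1 - a) := by
        have := hf0 x
        gcongr

lemma f_aemeas (hf0 : ∀ x, 0 ≤ f x)
    (hlc : ∀ x y : Fin d → ℝ, ∀ t : ℝ, t ∈ Set.Icc (0:ℝ) 1 →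
      f x ^ t * f y ^ (1 - t) ≤ f (t • x + (1 - t) • y)) : AEMeasurable f volume := by
  have : NullMeasurable f volume := by
    refine @measurable_of_Ici ℝ (NullMeasurableSpace (Fin d → ℝ) volume) _ _ _ _ _ _ _ f ?_
    intro s
    exact (lvl_convex hf0 hlc s).nullMeasurableSet volume
  exact this.aemeasurable

lemma f_le_zero (hf0 : ∀ x, 0 ≤ f x) (hsym : ∀ x, f (-x) = f x)
    (hlc : ∀ x y : Fin d → ℝ, ∀ t : ℝ, t ∈ Set.Icc (0:ℝ) 1 →
      f x ^ t * f y ^ (1 - t) ≤ f (t • x + (1 - t) • y)) (x : Fin d → ℝ) : f x ≤ f 0 := by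
  have h := lvl_convex hf0 hlc (f x) (x := x) (y := -x) (le_refl (f x)) (le_of_eq (hsym x).symm)
    (a := 1/2) (b := 1/2) (by norm_num) (by norm_num) (by norm_num)
  simpa using h

lemma mono_part (hf0 : ∀ x, 0 ≤ f x) (hsym : ∀ x, f (-x) = f x)
    (hlc : ∀ x y : Fin d → ℝ, ∀ t : ℝ, t ∈ Set.Icc (0:ℝ) 1 →
      f x ^ t * f y ^ (1 - t) ≤ f (t • x + (1 - t) • y))
    (S : Set (Fin d → ℝ)) (hS : Convex ℝ S) (hSs : S = -S) (v : Fin d → ℝ) (k₁ k₂ : ℝ)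
    (h0 : 0 ≤ k₁) (h12 : k₁ ≤ k₂) :
    volume.withDensity (fun x => ENNReal.ofReal (f x)) {x | x + k₂ • v ∈ S} ≤
      volume.withDensity (fun x => ENNReal.ofReal (f x)) {x | x + k₁ • v ∈ S} := by
  rcases h12.eq_or_lt with rfl | h12
  · exact le_rfl
  have hk : 0 < k₂ := h0.trans_lt h12
  let T : ℝ → Set (Fin d → ℝ) := fun k => {x | x + k • v ∈ S}
  have hT : ∀ k, Convex ℝ (T k) := by
    intro k x hx y hy a b ha hb hab
    have := hS hx hy ha hb hab
    show a • x + b • y + k • v ∈ S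
    convert this using 1
    obtain rfl : b = 1 - a := by linarith
    module
  have hTn : ∀ k, NullMeasurableSet (T k) := fun k => (hT k).nullMeasurableSet volume
  let F : ℝ → (Fin d → ℝ) → ℝ≥0∞ := fun k => (T k).indicator (fun x => ENNReal.ofReal (f x))
  have hI : ∀ k, volume.withDensity (fun x => ENNReal.ofReal (f x)) (T k) = ∫⁻ x, F k x := by
    intro k
    rw [withDensity_apply', lintegral_indicator₀ (hTn k)]
  show volume.withDensity _ (T k₂) ≤ volume.withDensity _ (T k₁)
  rw [hI, hI]
  have hneg : ∫⁻ x, F (-k₂) x = ∫⁻ x, F k₂ x := by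
    rw [← (Measure.measurePreserving_neg (volume : Measure (Fin d → ℝ))).lintegral_comp_emb
      (MeasurableEquiv.neg _).measurableEmbedding]
    apply lintegral_congr
    intro x
    have : (-x ∈ T (-k₂)) ↔ x ∈ T k₂ := by
      show -x + (-k₂) • v ∈ S ↔ x + k₂ • v ∈ S
      conv_lhs => rw [hSs]
      rw [Set.mem_neg]
      simp [add_comm]
    by_cases hx : x ∈ T k₂
    · simp [F, Set.indicator_of_mem hx, Set.indicator_of_mem (this.2 hx), hsym]
    · simp [F, Set.indicator_of_notMem hx, Set.indicator_of_notMem (mt this.1 hx)]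
  set t : ℝ := (1 + k₁ / k₂) / 2 with ht
  have hq0 : 0 ≤ k₁ / k₂ := by positivity
  have hq1 : k₁ / k₂ < 1 := (div_lt_one hk).2 h12
  have ht0 : 0 < t := by linarith
  have ht1 : t < 1 := by linarith
  have hH : AEMeasurable (F k₁) := (f_aemeas hf0 hlc).ennreal_ofReal.indicator₀ (hTn k₁)
  have := pln' ht0 ht1 (F := F k₂) (G := F (-k₂)) (H := F k₁) hH ?_
  · rwa [hneg, ← ENNReal.rpow_add_of_nonneg _ _ ht0.le (by linarith), add_sub_cancel,
      ENNReal.rpow_one] at this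
  · intro x y
    by_cases hx : x ∈ T k₂
    swap
    · simp [F, Set.indicator_of_notMem hx, ht0]
    by_cases hy : y ∈ T (-k₂)
    swap
    · simp [F, Set.indicator_of_notMem hy, ht1]
    have hz : t • x + (1 - t) • y ∈ T k₁ := by
      have := hS hx hy ht0.le (by linarith : 0 ≤ 1 - t) (by ring)
      show t • x + (1 - t) • y + k₁ • v ∈ S
      convert this using 1
      have : k₁ = t * k₂ - (1 - t) * k₂ := by rw [ht]; field_simp; ring
      rw [this]; module
    simp only [F, Set.indicator_of_mem hx, Set.indicator_of_mem hy, Set.indicator_of_mem hz]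
    rw [ENNReal.ofReal_rpow_of_nonneg (hf0 x) ht0.le,
      ENNReal.ofReal_rpow_of_nonneg (hf0 y) (by linarith),
      ← ENNReal.ofReal_mul (by have := hf0 x; positivity)]
    exact ENNReal.ofReal_le_ofReal (hlc x y t ⟨ht0.le, ht1.le⟩)

lemma combo_exists {m : ℕ} (K : Fin m → Set (Fin d → ℝ)) (hKc : ∀ i, Convex ℝ (K i))
    (hKs : ∀ i, K i = -K i) (hKb : ∀ i, Bornology.IsBounded (K i)) (w : ℝ≥0∞) (hw : w ≠ ⊤)
    (hA : ∑ i, w * volume (K i) ≠ 0) :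
    ∃ ν : ProbabilityMeasure (Fin d → ℝ), IsConvexComboOfSymmetricUniforms ν ∧
      (ν : Measure (Fin d → ℝ)) =
        (∑ i, w * volume (K i))⁻¹ • ∑ i, w • volume.restrict (K i) := by
  classical
  set A := ∑ i, w * volume (K i) with hAdef
  have hvol : ∀ i, volume (K i) ≠ ⊤ := fun i => (hKb i).measure_lt_top.ne
  have hAt : A ≠ ⊤ := ENNReal.sum_ne_top.2 fun i _ => ENNReal.mul_ne_top hw (hvol i)
  let L : Fin m → Set (Fin d → ℝ) := fun i =>
    if volume (K i) = 0 then Metric.closedBall 0 1 else closure (K i)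
  have hfr : ∀ i, volume (frontier (K i)) = 0 := fun i => (hKc i).addHaar_frontier volume
  have hLc : ∀ i, IsCompact (L i) := by
    intro i
    by_cases h : volume (K i) = 0
    · simp only [L, h, if_true]; exact isCompact_closedBall _ _
    · simp only [L, h, if_false]; exact (hKb i).isCompact_closure
  have hLpos : ∀ i, 0 < volume (L i) := by
    intro i
    by_cases h : volume (K i) = 0
    · simp only [L, h, if_true]; exact Metric.measure_closedBall_pos _ _ one_pos
    · simp only [L, h, if_false]
      exact (pos_iff_ne_zero.2 h).trans_le (measure_mono subset_closure)
  have hLt : ∀ i, volume (L i) ≠ ⊤ := fun i => (hLc i).measure_lt_top.ne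
  have hU : ∀ i, IsProbabilityMeasure ((volume (L i))⁻¹ • volume.restrict (L i)) := by
    intro i
    constructor
    simp [ENNReal.inv_mul_cancel (hLpos i).ne' (hLt i)]
  have hsum : (∑ i, A⁻¹ * (w * volume (K i))) = 1 := by
    rw [← Finset.mul_sum]; exact ENNReal.inv_mul_cancel hA hAt
  have hmeas : A⁻¹ • ∑ i, w • volume.restrict (K i) =
      ∑ i, (A⁻¹ * (w * volume (K i))) • ((volume (L i))⁻¹ • volume.restrict (L i)) := by
    rw [Finset.smul_sum]
    refine Finset.sum_congr rfl fun i _ => ?_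
    by_cases h : volume (K i) = 0
    · simp [h, Measure.restrict_eq_zero.2 h]
    · have hL : L i = closure (K i) := by simp only [L, h, if_false]
      rw [hL, Measure.restrict_congr_set (closure_ae_eq_of_null_frontier (hfr i)),
        measure_closure_of_null_frontier (hfr i), smul_smul, smul_smul]
      congr 1
      rw [mul_assoc, mul_assoc, ENNReal.mul_inv_cancel h (hvol i), mul_one]
  refine ⟨⟨A⁻¹ • ∑ i, w • volume.restrict (K i), ?_⟩, ?_, rfl⟩
  · constructor
    simp only [Measure.smul_apply, Measure.coe_finsetSum, Finset.sum_apply,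
      Measure.restrict_apply_univ, smul_eq_mul]
    exact ENNReal.inv_mul_cancel hA hAt
  · refine ⟨m, fun i => A⁻¹ * (w * volume (K i)),
      fun i => ⟨(volume (L i))⁻¹ • volume.restrict (L i), hU i⟩, hsum, ?_, hmeas⟩
    intro i
    refine ⟨L i, hLc i, ?_, ?_, hLpos i, rfl⟩
    · by_cases h : volume (K i) = 0
      · simp only [L, h, if_true]; exact convex_closedBall _ _
      · simp only [L, h, if_false]; exact (hKc i).closure
    · by_cases h : volume (K i) = 0
      · simp only [L, h, if_true]; simp
      · simp only [L, h, if_false]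
        conv_lhs => rw [hKs i]
        exact ((Homeomorph.neg (Fin d → ℝ)).preimage_closure (K i)).symm

lemma count_lemma {N : ℕ} (hN : 0 < N) {a c : ℝ} (ha : 0 ≤ a) (hc : 0 < c) (hac : a ≤ c)
    (w : ℝ≥0∞) :
    (∑ i : Fin N, if ((i : ℕ) + 1 : ℝ) * c / N ≤ a then w else 0) = ⌊a / c * N⌋₊ * w := by
  have hN' : (0:ℝ) < N := by exact_mod_cast hN
  rw [Fin.sum_univ_eq_sum_range (fun i : ℕ => if ((i : ℕ) + 1 : ℝ) * c / N ≤ a then w else 0),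
    ← Finset.sum_filter]
  have : (Finset.range N).filter (fun i : ℕ => ((i : ℕ) + 1 : ℝ) * c / N ≤ a) =
      Finset.range ⌊a / c * N⌋₊ := by
    ext i
    simp only [Finset.mem_filter, Finset.mem_range]
    have e : ((i : ℝ) + 1) * c / N ≤ a ↔ i < ⌊a / c * N⌋₊ := by
      rw [← Nat.succ_le_iff, Nat.le_floor_iff (by positivity), div_le_iff₀ hN', div_mul_eq_mul_div,
        le_div_iff₀ hc]
      push_cast
      rfl
    rw [e]
    constructor
    · exact fun h => h.2
    · intro h
      refine ⟨h.trans_le ?_, h⟩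
      apply Nat.floor_le_of_le
      have : a / c ≤ 1 := (div_le_one hc).2 hac
      nlinarith
  rw [this]
  simp

lemma ccu_part (μ : Measure (Fin d → ℝ)) [hμp : IsProbabilityMeasure μ]
    (hμ : μ = volume.withDensity (fun x => ENNReal.ofReal (f x)))
    (hf0 : ∀ x, 0 ≤ f x) (hsym : ∀ x, f (-x) = f x)
    (hlc : ∀ x y : Fin d → ℝ, ∀ t : ℝ, t ∈ Set.Icc (0:ℝ) 1 →
      f x ^ t * f y ^ (1 - t) ≤ f (t • x + (1 - t) • y)) : IsCentralConvexUnimodal μ := by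
  classical
  refine ⟨hμp, ?_⟩
  have hfm := (f_aemeas hf0 hlc).ennreal_ofReal
  have hle := f_le_zero hf0 hsym hlc
  set c := f 0 with hcdef
  have hc : 0 < c := by
    rcases (hf0 0).eq_or_lt with h | h
    · exfalso
      have : ∀ x, f x = 0 := fun x => le_antisymm ((hle x).trans h.symm.le) (hf0 x)
      have h0 : μ = 0 := by rw [hμ]; simp [this]
      exact IsProbabilityMeasure.ne_zero μ h0
    · exact h
  let K : (n : ℕ) → Fin (n + 1) → Set (Fin d → ℝ) := fun n i =>
    {x | ((i : ℕ) + 1 : ℝ) * c / ((n + 1 : ℕ) : ℝ) ≤ f x} ∩ Metric.closedBall 0 ((n + 1 : ℕ) : ℝ)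
  have hKc : ∀ n i, Convex ℝ (K n i) := fun n i =>
    (lvl_convex hf0 hlc _).inter (convex_closedBall _ _)
  have hKs : ∀ n i, K n i = -K n i := by
    intro n i
    ext x
    simp [K, hsym]
  have hKb : ∀ n i, Bornology.IsBounded (K n i) := fun n i =>
    Metric.isBounded_closedBall.subset Set.inter_subset_right
  have hKn : ∀ n i, NullMeasurableSet (K n i) := fun n i => (hKc n i).nullMeasurableSet volume
  let w : ℕ → ℝ≥0∞ := fun n => ENNReal.ofReal (c / ((n + 1 : ℕ) : ℝ))
  let A : ℕ → ℝ≥0∞ := fun n => ∑ i, w n * volume (K n i)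
  -- main convergence
  have conv : ∀ φ : BoundedContinuousFunction (Fin d → ℝ) NNReal,
      Filter.Tendsto (fun n => ∑ i, w n * ∫⁻ x in K n i, φ x) Filter.atTop
        (nhds (∫⁻ x, φ x ∂μ)) := by
    intro φ
    have hφm : Measurable fun x => (φ x : ℝ≥0∞) := φ.continuous.measurable.coe_nnreal_ennreal
    let Φ : ℕ → (Fin d → ℝ) → ℝ≥0∞ := fun n x =>
      ∑ i, (K n i).indicator (fun x => w n * φ x) x
    have hΦi : ∀ n, ∑ i, w n * ∫⁻ x in K n i, φ x = ∫⁻ x, Φ n x := by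
      intro n
      simp only [Φ]
      rw [lintegral_finsetSum' _ fun i _ => (hφm.const_mul _).aemeasurable.indicator₀ (hKn n i)]
      refine Finset.sum_congr rfl fun i _ => ?_
      rw [lintegral_indicator₀ (hKn n i), lintegral_const_mul _ hφm]
    have hμi : ∫⁻ x, φ x ∂μ = ∫⁻ x, ENNReal.ofReal (f x) * φ x := by
      rw [hμ, lintegral_withDensity_eq_lintegral_mul₀ hfm hφm.aemeasurable]
      rfl
    have hfin : ∫⁻ x, φ x ∂μ ≠ ⊤ := (φ.lintegral_lt_top_of_nnreal μ).ne
    have hΦv : ∀ n x, ‖x‖ ≤ ((n + 1 : ℕ) : ℝ) → Φ n x =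
        ENNReal.ofReal (c * (⌊f x / c * ((n + 1 : ℕ) : ℝ)⌋₊ / ((n + 1 : ℕ) : ℝ))) * φ x := by
      intro n x hx
      have h1 : Φ n x = ∑ i : Fin (n + 1),
          if ((i : ℕ) + 1 : ℝ) * c / ((n + 1 : ℕ) : ℝ) ≤ f x then w n * φ x else 0 := by
        refine Finset.sum_congr rfl fun i _ => ?_
        have hx' : x ∈ Metric.closedBall (0 : Fin d → ℝ) ((n + 1 : ℕ) : ℝ) := by
          simpa using hx
        rw [Set.indicator_apply]
        refine if_congr ?_ rfl rfl
        exact ⟨fun h => h.1, fun h => ⟨h, hx'⟩⟩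
      rw [h1, count_lemma (Nat.succ_pos n) (hf0 x) hc (hle x), ← mul_assoc]
      congr 1
      rw [← ENNReal.ofReal_natCast, ← ENNReal.ofReal_mul (Nat.cast_nonneg _)]
      congr 1
      ring
    have hΦ0 : ∀ n x, ¬ ‖x‖ ≤ ((n + 1 : ℕ) : ℝ) → Φ n x = 0 := by
      intro n x hx
      refine Finset.sum_eq_zero fun i _ => Set.indicator_of_notMem ?_ _
      rintro ⟨-, h⟩
      exact hx (by simpa using h)
    simp_rw [hΦi]
    rw [hμi] at hfin ⊢
    refine tendsto_lintegral_of_dominated_convergence' _ ?_ ?_ hfin ?_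
    · intro n
      exact Finset.aemeasurable_fun_sum _ fun i _ =>
        (hφm.const_mul _).aemeasurable.indicator₀ (hKn n i)
    · intro n
      refine Filter.Eventually.of_forall fun x => ?_
      by_cases hx : ‖x‖ ≤ ((n + 1 : ℕ) : ℝ)
      · rw [hΦv n x hx]
        show _ ≤ ENNReal.ofReal (f x) * (φ x : ℝ≥0∞)
        gcongr
        have hN : (0:ℝ) < ((n + 1 : ℕ) : ℝ) := by positivity
        have := Nat.floor_le (a := f x / c * ((n + 1 : ℕ) : ℝ)) (by have := hf0 x; positivity)
        calc c * (⌊f x / c * ((n + 1 : ℕ) : ℝ)⌋₊ / ((n + 1 : ℕ) : ℝ))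
            ≤ c * ((f x / c * ((n + 1 : ℕ) : ℝ)) / ((n + 1 : ℕ) : ℝ)) := by gcongr
          _ = f x := by field_simp
      · rw [hΦ0 n x hx]; exact zero_le
    · refine Filter.Eventually.of_forall fun x => ?_
      have hN : Filter.Tendsto (fun n : ℕ => ((n + 1 : ℕ) : ℝ)) Filter.atTop Filter.atTop :=
        tendsto_natCast_atTop_atTop.comp (Filter.tendsto_add_atTop_nat 1)
      have l1 := (tendsto_nat_floor_mul_div_atTop (R := ℝ) (a := f x / c)
        (div_nonneg (hf0 x) hc.le)).comp hN
      have l2 := l1.const_mul c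
      rw [mul_div_cancel₀ _ hc.ne'] at l2
      have l3 := ENNReal.Tendsto.mul_const (b := (φ x : ℝ≥0∞)) (ENNReal.tendsto_ofReal l2)
        (Or.inr ENNReal.coe_ne_top)
      refine l3.congr' ?_
      filter_upwards [hN.eventually_ge_atTop ‖x‖] with n hn
      rw [hΦv n x hn]
      rfl
  have hA : Filter.Tendsto A Filter.atTop (nhds 1) := by
    have := conv 1
    simpa [A] using this
  have hA0 : ∀ᶠ n in Filter.atTop, A n ≠ 0 := hA.eventually_ne one_ne_zero
  have hex : ∀ n, ∃ ν : ProbabilityMeasure (Fin d → ℝ), A n ≠ 0 →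
      IsConvexComboOfSymmetricUniforms ν ∧
      (ν : Measure (Fin d → ℝ)) = (A n)⁻¹ • ∑ i, w n • volume.restrict (K n i) := by
    intro n
    by_cases h : A n = 0
    · exact ⟨⟨μ, hμp⟩, fun h' => absurd h h'⟩
    · obtain ⟨ν, hν⟩ := combo_exists (K n) (hKc n) (hKs n) (hKb n) (w n) ENNReal.ofReal_ne_top h
      exact ⟨ν, fun _ => hν⟩
  choose ν hν using hex
  obtain ⟨P, hP, hPe⟩ : ∃ P : ProbabilityMeasure (Fin d → ℝ), (P : Measure (Fin d → ℝ)) = μ ∧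
      P = ⟨μ, hμp⟩ := ⟨⟨μ, hμp⟩, rfl, rfl⟩
  have hT : Filter.Tendsto ν Filter.atTop (nhds P) := by
    rw [ProbabilityMeasure.tendsto_iff_forall_lintegral_tendsto]
    intro φ
    have hlim := ENNReal.Tendsto.mul (ENNReal.tendsto_inv_iff.2 hA) (Or.inl (by simp)) (conv φ)
      (Or.inr (by simp))
    rw [inv_one, one_mul] at hlim
    rw [hP]
    refine hlim.congr' ?_
    filter_upwards [hA0] with n hn
    rw [(hν n hn).2, lintegral_smul_measure, lintegral_finsetSum_measure]
    simp [lintegral_smul_measure]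
  have hm : P ∈ closure {ν | IsConvexComboOfSymmetricUniforms ν} :=
    mem_closure_of_tendsto hT (hA0.mono fun n hn => (hν n hn).1)
  rw [hPe] at hm
  exact hm

end

/-- **Symmetric log-concave distributions are central convex unimodal, hence monotone
unimodal.** If `μ` is absolutely continuous with a centrally symmetric log-concave
density `f`, then `μ` is central convex unimodal, and for every symmetric convex set
`S` and nonzero `v`, `k ↦ μ {x | x + k • v ∈ S}` is non-increasing on `[0, ∞)`. -/
theorem logConcave_symmetric_centralConvexUnimodal
    {d : ℕ} (μ : Measure (Fin d → ℝ)) [IsProbabilityMeasure μ]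
    (f : (Fin d → ℝ) → ℝ) (hf0 : ∀ x, 0 ≤ f x)
    (hμ : μ = volume.withDensity (fun x => ENNReal.ofReal (f x)))
    (hsym : ∀ x, f (-x) = f x)
    (hlogconcave : ∀ x y : Fin d → ℝ, ∀ t : ℝ, t ∈ Set.Icc (0:ℝ) 1 →
      f x ^ t * f y ^ (1 - t) ≤ f (t • x + (1 - t) • y)) :
    IsCentralConvexUnimodal μ ∧
    (∀ S : Set (Fin d → ℝ), Convex ℝ S → S = -S →
      ∀ v : Fin d → ℝ, v ≠ 0 → ∀ k₁ k₂ : ℝ, 0 ≤ k₁ → k₁ ≤ k₂ →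
        μ {x | x + k₂ • v ∈ S} ≤ μ {x | x + k₁ • v ∈ S}) := by
  refine ⟨ccu_part μ hμ hf0 hsym hlogconcave, ?_⟩
  intro S hS hSs v _ k₁ k₂ h0 h12
  rw [hμ]
  exact mono_part hf0 hsym hlogconcave S hS hSs v k₁ k₂ h0 h12
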